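/- Let 1 < p < ∞ and 0 < λ < p − 1, and set K = (λ/(p−1))^{1/p}. For every function u : [0,π_p] → ℝ that is continuously differentiable on [0,π_p] with u(0) = u(π_p) = 0, the Sobolev-type inequality holds: 2·K^{p−1}·(cot_p(K·π_p/2))^{p−1}·(max_{x∈[0,π_p]} |u(x)|)^p ≤ ∫₀^{π_p} |u′(x)|^p dx − λ∫₀^{π_p} |u(x)|^p dx. -/

import Mathlib

/-- `arcsin_p x = ∫₀ˣ (1 - tᵖ)^(-1/p) dt`. -/
noncomputable def arcsinP (p x : ℝ) : ℝ := ∫ t in (0:ℝ)..x, (1 - t ^ p) ^ (-(1 / p))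

/-- The generalized π: `π_p = 2 arcsin_p 1`. -/
noncomputable def piP (p : ℝ) : ℝ := 2 * arcsinP p 1

/-- `sin_p` on `[0, π_p/2]`, defined as the inverse of `arcsin_p : [0,1] → [0, π_p/2]`. -/
noncomputable def sinPHalf (p : ℝ) : ℝ → ℝ := Function.invFunOn (arcsinP p) (Set.Icc 0 1)

/-- `sin_p` on `[0, π_p]`, extended by `sin_p x = sin_p (π_p - x)`. -/
noncomputable def sinP (p x : ℝ) : ℝ :=
  if x ≤ piP p / 2 then sinPHalf p x else sinPHalf p (piP p - x)

/-- `cos_p x = (1 - sin_p x ^ p)^(1/p)` on `[0, π_p/2]`, with minus sign on `[π_p/2, π_p]`. -/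
noncomputable def cosP (p x : ℝ) : ℝ :=
  if x ≤ piP p / 2 then (1 - sinP p x ^ p) ^ (1 / p)
  else -((1 - sinP p x ^ p) ^ (1 / p))

/-- `cot_p x = cos_p x / sin_p x`. -/
noncomputable def cotP (p x : ℝ) : ℝ := cosP p x / sinP p x


lemma arc_base {p t : ℝ} (hp : 1 < p) (h0 : 0 ≤ t) (h1 : t < 1) : 0 < 1 - t ^ p := by
  have := Real.rpow_lt_one h0 h1 (by linarith : 0 < p)
  linarith

lemma arc_int {p : ℝ} (hp : 1 < p) :
    IntervalIntegrable (fun t : ℝ => (1 - t ^ p) ^ (-(1 / p))) MeasureTheory.volume 0 1 := by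
  have hlt : (-1:ℝ) < -(1 / p) := by
    have : 1 / p < 1 := by rw [div_lt_one] <;> linarith
    linarith
  have h1 : IntervalIntegrable (fun t : ℝ => (1 - t) ^ (-(1 / p))) MeasureTheory.volume 0 1 := by
    have := (intervalIntegral.intervalIntegrable_rpow' (a := 0) (b := 1) hlt).comp_sub_left 1
    simpa using this.symm
  refine h1.mono_fun ?_ ?_
  · apply Measurable.aestronglyMeasurable
    fun_prop
  · rw [Set.uIoc_of_le zero_le_one]
    refine (MeasureTheory.ae_restrict_iff' measurableSet_Ioc).2 (Filter.Eventually.of_forall ?_)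
    intro t ht
    rcases eq_or_lt_of_le ht.2 with h | h
    · subst h; simp
    · have hb := arc_base hp ht.1.le h
      have hb2 : 1 - t ≤ 1 - t ^ p := by
        have := Real.rpow_le_rpow_of_exponent_ge ht.1 ht.2 hp.le
        rw [Real.rpow_one] at this
        linarith
      beta_reduce
      rw [Real.norm_of_nonneg (Real.rpow_nonneg hb.le _),
        Real.norm_of_nonneg (Real.rpow_nonneg (by linarith) _)]
      exact Real.rpow_le_rpow_of_nonpos (by linarith) hb2 (by
        have : 0 < 1 / p := by positivity
        linarith)

lemma arc_int' {p a b : ℝ} (hp : 1 < p) (ha : a ∈ Set.Icc (0:ℝ) 1) (hb : b ∈ Set.Icc (0:ℝ) 1) :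
    IntervalIntegrable (fun t : ℝ => (1 - t ^ p) ^ (-(1 / p))) MeasureTheory.volume a b := by
  refine (arc_int hp).mono_set ?_
  rw [Set.uIcc_of_le zero_le_one]
  exact Set.uIcc_subset_Icc ha hb

lemma arc_contAt {p t : ℝ} (hp : 1 < p) (h0 : 0 ≤ t) (h1 : t < 1) :
    ContinuousAt (fun t : ℝ => (1 - t ^ p) ^ (-(1 / p))) t := by
  have := arc_base hp h0 h1
  refine ContinuousAt.rpow_const ?_ (Or.inl this.ne')
  exact continuousAt_const.sub (Real.continuousAt_rpow_const _ _ (Or.inr (by linarith)))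

lemma arc_deriv {p t : ℝ} (hp : 1 < p) (h0 : 0 ≤ t) (h1 : t < 1) :
    HasDerivAt (arcsinP p) ((1 - t ^ p) ^ (-(1 / p))) t := by
  unfold arcsinP
  refine intervalIntegral.integral_hasDerivAt_right
    (arc_int' hp ⟨le_rfl, zero_le_one⟩ ⟨h0, h1.le⟩) ?_ (arc_contAt hp h0 h1)
  have hm : Measurable (fun t : ℝ => (1 - t ^ p) ^ (-(1 / p))) := by fun_prop
  exact hm.stronglyMeasurable.stronglyMeasurableAtFilter

lemma arc_cont {p : ℝ} (hp : 1 < p) : ContinuousOn (arcsinP p) (Set.Icc 0 1) := by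
  unfold arcsinP
  have := intervalIntegral.continuousOn_primitive_interval
    (μ := MeasureTheory.volume) (f := fun t : ℝ => (1 - t ^ p) ^ (-(1 / p))) (a := 0) (b := 1) ?_
  · rwa [Set.uIcc_of_le zero_le_one] at this
  · rw [Set.uIcc_of_le zero_le_one]
    exact (intervalIntegrable_iff_integrableOn_Icc_of_le zero_le_one).1 (arc_int hp)

lemma arc_mono {p : ℝ} (hp : 1 < p) : StrictMonoOn (arcsinP p) (Set.Icc 0 1) := by
  refine strictMonoOn_of_deriv_pos (convex_Icc 0 1) (arc_cont hp) ?_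
  intro x hx
  rw [interior_Icc] at hx
  rw [(arc_deriv hp hx.1.le hx.2).deriv]
  exact Real.rpow_pos_of_pos (arc_base hp hx.1.le hx.2) _

lemma arc_zero (p : ℝ) : arcsinP p 0 = 0 := by simp [arcsinP]

lemma arc_one (p : ℝ) : arcsinP p 1 = piP p / 2 := by simp [piP]

lemma piP_pos {p : ℝ} (hp : 1 < p) : 0 < piP p := by
  have := arc_mono hp (⟨le_rfl, zero_le_one⟩ : (0:ℝ) ∈ Set.Icc (0:ℝ) 1)
    (⟨zero_le_one, le_rfl⟩ : (1:ℝ) ∈ Set.Icc (0:ℝ) 1) zero_lt_one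
  rw [arc_zero, arc_one] at this
  linarith

lemma arc_surj {p x : ℝ} (hp : 1 < p) (hx : x ∈ Set.Icc 0 (piP p / 2)) :
    ∃ y ∈ Set.Icc (0:ℝ) 1, arcsinP p y = x := by
  have := intermediate_value_Icc zero_le_one (arc_cont hp)
  rw [arc_zero, arc_one] at this
  exact this hx

lemma sinH_mem {p x : ℝ} (hp : 1 < p) (hx : x ∈ Set.Icc 0 (piP p / 2)) :
    sinPHalf p x ∈ Set.Icc (0:ℝ) 1 := Function.invFunOn_mem (arc_surj hp hx)

lemma arc_sinH {p x : ℝ} (hp : 1 < p) (hx : x ∈ Set.Icc 0 (piP p / 2)) :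
    arcsinP p (sinPHalf p x) = x := Function.invFunOn_eq (arc_surj hp hx)

lemma arc_mem {p y : ℝ} (hp : 1 < p) (hy : y ∈ Set.Icc (0:ℝ) 1) :
    arcsinP p y ∈ Set.Icc 0 (piP p / 2) := by
  rw [← arc_zero p, ← arc_one p]
  exact ⟨(arc_mono hp).monotoneOn ⟨le_rfl, zero_le_one⟩ hy hy.1,
    (arc_mono hp).monotoneOn hy ⟨zero_le_one, le_rfl⟩ hy.2⟩

lemma sinH_arc {p y : ℝ} (hp : 1 < p) (hy : y ∈ Set.Icc (0:ℝ) 1) :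
    sinPHalf p (arcsinP p y) = y :=
  (arc_mono hp).injOn (sinH_mem hp (arc_mem hp hy)) hy (arc_sinH hp (arc_mem hp hy))

lemma sinH_mono {p : ℝ} (hp : 1 < p) : StrictMonoOn (sinPHalf p) (Set.Icc 0 (piP p / 2)) := by
  intro x hx y hy hxy
  rw [← (arc_mono hp).lt_iff_lt (sinH_mem hp hx) (sinH_mem hp hy), arc_sinH hp hx, arc_sinH hp hy]
  exact hxy

lemma sinH_image {p : ℝ} (hp : 1 < p) :
    sinPHalf p '' (Set.Icc 0 (piP p / 2)) = Set.Icc 0 1 := by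
  ext y
  constructor
  · rintro ⟨x, hx, rfl⟩; exact sinH_mem hp hx
  · intro hy; exact ⟨_, arc_mem hp hy, sinH_arc hp hy⟩

lemma sinH_pi {p : ℝ} (hp : 1 < p) : sinPHalf p (piP p / 2) = 1 := by
  rw [← arc_one]; exact sinH_arc hp ⟨zero_le_one, le_rfl⟩

lemma sinH_zero {p : ℝ} (hp : 1 < p) : sinPHalf p 0 = 0 := by
  have := sinH_arc hp (⟨le_rfl, zero_le_one⟩ : (0:ℝ) ∈ Set.Icc (0:ℝ) 1)
  rwa [arc_zero] at this

lemma sinH_Ioo {p x : ℝ} (hp : 1 < p) (hx : x ∈ Set.Ioo 0 (piP p / 2)) :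
    sinPHalf p x ∈ Set.Ioo (0:ℝ) 1 := by
  have hP := piP_pos hp
  constructor
  · rw [← sinH_zero hp]
    exact sinH_mono hp ⟨le_rfl, by linarith⟩ ⟨hx.1.le, hx.2.le⟩ hx.1
  · rw [← sinH_pi hp]
    exact sinH_mono hp ⟨hx.1.le, hx.2.le⟩ ⟨by linarith, le_rfl⟩ hx.2

lemma sinH_contAt {p x : ℝ} (hp : 1 < p) (hx : x ∈ Set.Ioo 0 (piP p / 2)) :
    ContinuousAt (sinPHalf p) x := by
  refine (sinH_mono hp).continuousAt_of_image_mem_nhds (Icc_mem_nhds hx.1 hx.2) ?_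
  rw [sinH_image hp]
  exact Icc_mem_nhds (sinH_Ioo hp hx).1 (sinH_Ioo hp hx).2

lemma sinH_contL {p : ℝ} (hp : 1 < p) :
    ContinuousWithinAt (sinPHalf p) (Set.Iic (piP p / 2)) (piP p / 2) := by
  have hP := piP_pos hp
  refine (sinH_mono hp).continuousWithinAt_left_of_image_mem_nhdsWithin
    (Icc_mem_nhdsLE (by linarith)) ?_
  rw [sinH_image hp, sinH_pi hp]
  exact Icc_mem_nhdsLE zero_lt_one

lemma sinH_deriv {p x : ℝ} (hp : 1 < p) (hx : x ∈ Set.Ioo 0 (piP p / 2)) :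
    HasDerivAt (sinPHalf p) ((1 - sinPHalf p x ^ p) ^ (1 / p)) x := by
  have hs := sinH_Ioo hp hx
  have hb := arc_base hp hs.1.le hs.2
  have h := HasDerivAt.of_local_left_inverse (f := arcsinP p) (g := sinPHalf p) (a := x)
    (sinH_contAt hp hx) (arc_deriv hp hs.1.le hs.2) (Real.rpow_pos_of_pos hb _).ne' ?_
  · rwa [Real.rpow_neg hb.le, inv_inv] at h
  · filter_upwards [Icc_mem_nhds hx.1 hx.2] with y hy
    exact arc_sinH hp hy

/-- the function `cot_p ^ (p-1)` on the first half -/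
noncomputable def hcot (p x : ℝ) : ℝ := (sinPHalf p x ^ (-p) - 1) ^ ((p - 1) / p)

lemma hcot_base {p x : ℝ} (hp : 1 < p) (hx : x ∈ Set.Ioo 0 (piP p / 2)) :
    0 < sinPHalf p x ^ (-p) - 1 := by
  have hs := sinH_Ioo hp hx
  have := Real.one_lt_rpow_of_pos_of_lt_one_of_neg hs.1 hs.2 (by linarith : -p < 0)
  linarith

lemma hcot_pos {p x : ℝ} (hp : 1 < p) (hx : x ∈ Set.Ioo 0 (piP p / 2)) : 0 < hcot p x :=
  Real.rpow_pos_of_pos (hcot_base hp hx) _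

lemma hcot_pi {p : ℝ} (hp : 1 < p) : hcot p (piP p / 2) = 0 := by
  have : (p - 1) / p ≠ 0 := (div_pos (by linarith) (by linarith)).ne'
  simp [hcot, sinH_pi hp, this]

lemma hcot_contL {p : ℝ} (hp : 1 < p) :
    ContinuousWithinAt (hcot p) (Set.Iic (piP p / 2)) (piP p / 2) := by
  have : 0 ≤ (p - 1) / p := (div_pos (by linarith) (by linarith)).le
  unfold hcot
  refine ContinuousWithinAt.rpow_const ?_ (Or.inr this)
  refine ContinuousWithinAt.sub ?_ continuousWithinAt_const
  refine (sinH_contL hp).rpow_const (Or.inl ?_)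
  rw [sinH_pi hp]; norm_num

lemma hcot_deriv {p x : ℝ} (hp : 1 < p) (hx : x ∈ Set.Ioo 0 (piP p / 2)) :
    HasDerivAt (hcot p) (-(p - 1) * (1 + |hcot p x| ^ (p / (p - 1)))) x := by
  have hs := sinH_Ioo hp hx
  have hb := hcot_base hp hx
  have hb2 := arc_base hp hs.1.le hs.2
  have hp0 : p ≠ 0 := by linarith
  have hp1 : p - 1 ≠ 0 := by linarith
  have h := (((sinH_deriv hp hx).rpow_const (p := -p) (Or.inl hs.1.ne')).sub_const 1).rpow_const
    (p := (p - 1) / p) (Or.inl hb.ne')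
  unfold hcot
  convert h using 1
  rw [abs_of_nonneg (Real.rpow_nonneg hb.le _), ← Real.rpow_mul hb.le,
    show (p - 1) / p * (p / (p - 1)) = 1 by field_simp, Real.rpow_one]
  set s := sinPHalf p x with hsd
  have e1 : s ^ (-p) - 1 = (1 - s ^ p) * s ^ (-p) := by
    rw [sub_mul, one_mul, ← Real.rpow_add hs.1]; simp
  rw [show (p - 1) / p - 1 = -(1 / p) by field_simp; ring, e1,
    Real.mul_rpow hb2.le (Real.rpow_nonneg hs.1.le _), ← Real.rpow_mul hs.1.le,
    Real.rpow_neg hb2.le, show -p * -(1 / p) = 1 by field_simp, Real.rpow_one,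
    show (1 - s ^ p) * s ^ (-p) = s ^ (-p) - 1 from e1.symm,
    Real.rpow_sub hs.1, Real.rpow_one]
  have := (Real.rpow_pos_of_pos hb2 (1 / p)).ne'
  have := hs.1.ne'
  field_simp
  ring

lemma hcot_eq {p x : ℝ} (hp : 1 < p) (hx : x ∈ Set.Ioo 0 (piP p / 2)) :
    hcot p x = ((1 - sinPHalf p x ^ p) ^ (1 / p) / sinPHalf p x) ^ (p - 1) := by
  have hs := sinH_Ioo hp hx
  have hb := hcot_base hp hx
  have hb2 := arc_base hp hs.1.le hs.2
  unfold hcot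
  set s := sinPHalf p x with hsd
  have e1 : s ^ (-p) - 1 = (1 - s ^ p) * s ^ (-p) := by
    rw [sub_mul, one_mul, ← Real.rpow_add hs.1]; simp
  rw [e1, show (p - 1) / p = (1 / p) * (p - 1) by ring, Real.rpow_mul (by rw [← e1]; exact hb.le),
    Real.mul_rpow hb2.le (Real.rpow_nonneg hs.1.le _), ← Real.rpow_mul hs.1.le,
    show -p * (1 / p) = -1 by field_simp, Real.rpow_neg_one, ← div_eq_mul_inv]

lemma hcot_le {p x : ℝ} (hp : 1 < p) (hx : x ∈ Set.Ioo 0 (piP p / 2)) :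
    hcot p x ≤ x ^ (1 - p) := by
  have hs := sinH_Ioo hp hx
  have hb2 := arc_base hp hs.1.le hs.2
  rw [hcot_eq hp hx, show 1 - p = -1 * (p - 1) by ring, Real.rpow_mul hx.1.le, Real.rpow_neg_one]
  have hpos := Real.rpow_pos_of_pos hb2 (1 / p)
  refine Real.rpow_le_rpow (div_pos hpos hs.1).le ?_ (by linarith)
  rw [div_le_iff₀ hs.1, inv_mul_eq_div, le_div_iff₀ hx.1]
  have key : arcsinP p (sinPHalf p x) ≤
      ∫ t in (0:ℝ)..(sinPHalf p x), ((1 - sinPHalf p x ^ p) ^ (-(1 / p)) : ℝ) := by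
    unfold arcsinP
    refine intervalIntegral.integral_mono_on hs.1.le
      (arc_int' hp ⟨le_rfl, zero_le_one⟩ ⟨hs.1.le, hs.2.le⟩) (by simp) ?_
    intro t ht
    refine Real.rpow_le_rpow_of_nonpos hb2 ?_ ?_
    · have := Real.rpow_le_rpow ht.1 ht.2 (by linarith : 0 ≤ p)
      linarith
    · have : 0 < 1 / p := by positivity
      linarith
  rw [arc_sinH hp ⟨hx.1.le, hx.2.le⟩, intervalIntegral.integral_const, smul_eq_mul, sub_zero,
    Real.rpow_neg hb2.le, ← div_eq_mul_inv, le_div_iff₀ hpos] at key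
  linarith

/-- signed `cot_p ^ (p-1)` on `(0, π_p)` -/
noncomputable def Fcot (p x : ℝ) : ℝ :=
  if x ≤ piP p / 2 then hcot p x else -hcot p (piP p - x)

lemma Fcot_left {p x : ℝ} (hx : x ≤ piP p / 2) : Fcot p x = hcot p x := by simp [Fcot, hx]

lemma Fcot_right {p x : ℝ} (hp : 1 < p) (hx : piP p / 2 ≤ x) :
    Fcot p x = -hcot p (piP p - x) := by
  rcases eq_or_lt_of_le hx with h | h
  · rw [Fcot_left h.ge, ← h, show piP p - piP p / 2 = piP p / 2 by ring, hcot_pi hp]; simp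
  · simp [Fcot, not_le.2 h]

lemma Fcot_symm {p x : ℝ} (hp : 1 < p) : Fcot p (piP p - x) = -Fcot p x := by
  rcases le_total x (piP p / 2) with h | h
  · rw [Fcot_right hp (by linarith), Fcot_left h]; simp
  · rw [Fcot_left (by linarith), Fcot_right hp h]; simp

lemma hcot_derivL {p : ℝ} (hp : 1 < p) :
    HasDerivWithinAt (hcot p) (-(p - 1)) (Set.Iic (piP p / 2)) (piP p / 2) := by
  have hP := piP_pos hp
  have hq : 0 < p / (p - 1) := div_pos (by linarith) (by linarith)
  have hmem : Set.Ioo 0 (piP p / 2) ∈ nhdsWithin (piP p / 2) (Set.Iio (piP p / 2)) :=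
    Ioo_mem_nhdsLT (by linarith)
  refine hasDerivWithinAt_Iic_of_tendsto_deriv (s := Set.Ioo 0 (piP p / 2)) ?_ ?_ hmem ?_
  · intro x hx
    exact (hcot_deriv hp hx).differentiableAt.differentiableWithinAt
  · exact (hcot_contL hp).mono (fun x hx => hx.2.le)
  · have h1 : Filter.Tendsto (hcot p) (nhdsWithin (piP p / 2) (Set.Iio (piP p / 2))) (nhds 0) := by
      have := (hcot_contL hp).mono (Set.Iio_subset_Iic_self)
      unfold ContinuousWithinAt at this
      rwa [hcot_pi hp] at this
    have h2 : Filter.Tendsto (fun x => -(p - 1) * (1 + |hcot p x| ^ (p / (p - 1))))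
        (nhdsWithin (piP p / 2) (Set.Iio (piP p / 2))) (nhds (-(p - 1))) := by
      have := ((h1.abs.rpow_const (p := p / (p - 1)) (Or.inr hq.le)).const_add 1).const_mul (-(p - 1))
      simpa [Real.zero_rpow hq.ne'] using this
    refine h2.congr' ?_
    filter_upwards [hmem] with x hx
    exact (hcot_deriv hp hx).deriv.symm

lemma Fcot_deriv {p x : ℝ} (hp : 1 < p) (hx : x ∈ Set.Ioo 0 (piP p)) :
    HasDerivAt (Fcot p) (-(p - 1) * (1 + |Fcot p x| ^ (p / (p - 1)))) x := by
  have hq : 0 < p / (p - 1) := div_pos (by linarith) (by linarith)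
  rcases lt_trichotomy x (piP p / 2) with h | h | h
  · rw [Fcot_left h.le]
    refine (hcot_deriv hp ⟨hx.1, h⟩).congr_of_eventuallyEq ?_
    filter_upwards [Iio_mem_nhds h] with y hy
    exact Fcot_left (le_of_lt hy)
  · subst h
    rw [Fcot_left le_rfl, hcot_pi hp, abs_zero, Real.zero_rpow hq.ne', add_zero, mul_one]
    have hL : HasDerivWithinAt (Fcot p) (-(p - 1)) (Set.Iic (piP p / 2)) (piP p / 2) :=
      (hcot_derivL hp).congr (fun y hy => Fcot_left hy) (Fcot_left le_rfl)
    have hR : HasDerivWithinAt (Fcot p) (-(p - 1)) (Set.Ici (piP p / 2)) (piP p / 2) := by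
      have hm : HasDerivWithinAt (fun y => piP p - y) (-1) (Set.Ici (piP p / 2)) (piP p / 2) :=
        ((hasDerivAt_id _).const_sub _).hasDerivWithinAt
      have e : piP p - piP p / 2 = piP p / 2 := by ring
      have h0 : HasDerivWithinAt (hcot p) (-(p - 1)) (Set.Iic (piP p / 2))
          (piP p - piP p / 2) := by rw [e]; exact hcot_derivL hp
      have := (h0.comp (piP p / 2) hm (fun y hy => by
        simp only [Set.mem_Ici, Set.mem_Iic] at *; linarith)).neg
      refine (this.congr_deriv (by ring)).congr (fun y hy => ?_) ?_
      · exact Fcot_right hp hy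
      · exact Fcot_right hp le_rfl
    have := hL.union hR
    rwa [Set.Iic_union_Ici, hasDerivWithinAt_univ] at this
  · rw [Fcot_right hp h.le, abs_neg]
    have hm : HasDerivAt (fun y => piP p - y) (-1) x := (hasDerivAt_id _).const_sub _
    have h1 := ((hcot_deriv hp (x := piP p - x) ⟨by linarith [hx.2], by linarith⟩).comp x hm).neg
    refine (h1.congr_deriv (by ring)).congr_of_eventuallyEq ?_
    filter_upwards [Ioi_mem_nhds h] with y hy
    exact Fcot_right hp (le_of_lt hy)

lemma Fcot_anti {p : ℝ} (hp : 1 < p) : AntitoneOn (Fcot p) (Set.Ioo 0 (piP p)) := by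
  refine antitoneOn_of_deriv_nonpos (convex_Ioo _ _)
    (fun x hx => (Fcot_deriv hp hx).continuousAt.continuousWithinAt) ?_ ?_
  · rw [interior_Ioo]
    exact fun x hx => (Fcot_deriv hp hx).differentiableAt.differentiableWithinAt
  · rw [interior_Ioo]
    intro x hx
    rw [(Fcot_deriv hp hx).deriv]
    have : 0 ≤ |Fcot p x| ^ (p / (p - 1)) := by positivity
    nlinarith

lemma Fcot_sum {p m t : ℝ} (hp : 1 < p) (hm : m ≤ piP p / 2) (ht0 : 0 ≤ t) (ht : t < m) :
    2 * Fcot p m ≤ Fcot p (m - t) + Fcot p (m + t) := by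
  have hP := piP_pos hp
  have hq : 0 < p / (p - 1) := div_pos (by linarith) (by linarith)
  have hd : ∀ s ∈ Set.Ico 0 m, HasDerivAt (fun s => Fcot p (m - s) + Fcot p (m + s))
      ((p - 1) * (|Fcot p (m - s)| ^ (p / (p - 1)) - |Fcot p (m + s)| ^ (p / (p - 1)))) s := by
    intro s hs
    have h1 : HasDerivAt (fun y => m - y) (-1) s := (hasDerivAt_id _).const_sub _
    have h2 : HasDerivAt (fun y => m + y) 1 s := (hasDerivAt_id _).const_add _
    have h3 := (Fcot_deriv hp (x := m - s)
      ⟨by linarith [hs.2], by linarith [hs.1]⟩).comp s h1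
    have h4 := (Fcot_deriv hp (x := m + s)
      ⟨by linarith [hs.2, hs.1], by linarith [hs.2]⟩).comp s h2
    exact (h3.add h4).congr_deriv (by ring)
  have hmono : MonotoneOn (fun s => Fcot p (m - s) + Fcot p (m + s)) (Set.Ico 0 m) := by
    refine monotoneOn_of_deriv_nonneg (convex_Ico _ _)
      (fun x hx => (hd x hx).continuousAt.continuousWithinAt) ?_ ?_
    · exact fun x hx => (hd x (interior_subset hx)).differentiableAt.differentiableWithinAt
    · intro s hs
      have hs := interior_subset hs
      rw [(hd s hs).deriv]
      refine mul_nonneg (by linarith) (sub_nonneg.2 ?_)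
      have ha : m - s ∈ Set.Ioo 0 (piP p) := ⟨by linarith [hs.2], by linarith [hs.1]⟩
      have hb : m + s ∈ Set.Ioo 0 (piP p) := ⟨by linarith [hs.1, hs.2], by linarith [hs.2]⟩
      have i1 := Fcot_anti hp ha hb (by linarith [hs.1])
      have hc : piP p - (m + s) ∈ Set.Ioo 0 (piP p) := ⟨by linarith [hb.2], by linarith [hb.1]⟩
      have i2 := Fcot_anti hp ha hc (by linarith)
      rw [Fcot_symm hp] at i2
      refine Real.rpow_le_rpow (abs_nonneg _) ?_ hq.le
      exact (abs_le.2 ⟨by linarith, i1⟩).trans (le_abs_self _)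
  have := hmono ⟨le_rfl, by linarith⟩ ⟨ht0, ht⟩ ht0
  simp only [sub_zero, add_zero] at this
  linarith

lemma young_aux {p : ℝ} (hp : 1 < p) (G w v : ℝ) :
    G * (p * |w| ^ (p - 2) * w * v) ≤ |v| ^ p + (p - 1) * |G| ^ (p / (p - 1)) * |w| ^ p := by
  have hp0 : 0 < p := by linarith
  have hp1 : 0 < p - 1 := by linarith
  by_cases hw : w = 0
  · subst hw
    simp only [abs_zero, mul_zero, zero_mul, Real.zero_rpow hp0.ne']
    have : 0 ≤ |v| ^ p := by positivity
    linarith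
  have hwp := abs_pos.2 hw
  have hq : p.HolderConjugate (p / (p - 1)) := Real.HolderConjugate.conjExponent hp
  have h := Real.young_inequality v (G * (|w| ^ (p - 2) * w)) hq
  have e : |G * (|w| ^ (p - 2) * w)| ^ (p / (p - 1)) = |G| ^ (p / (p - 1)) * |w| ^ p := by
    rw [abs_mul, abs_mul, abs_of_nonneg (Real.rpow_nonneg hwp.le (p - 2)),
      Real.mul_rpow (abs_nonneg _) (by positivity)]
    congr 1
    nth_rewrite 2 [← Real.rpow_one |w|]
    rw [← Real.rpow_add hwp, ← Real.rpow_mul hwp.le]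
    congr 1
    field_simp
    ring
  rw [e] at h
  have h2 := mul_le_mul_of_nonneg_left h hp0.le
  have e2 : p * (|v| ^ p / p + |G| ^ (p / (p - 1)) * |w| ^ p / (p / (p - 1))) =
    |v| ^ p + (p - 1) * |G| ^ (p / (p - 1)) * |w| ^ p := by field_simp
  rw [e2] at h2
  linarith

lemma half_ineq {p lam K c : ℝ} (hp : 1 < p) (hK : 0 < K) (hlam : (p - 1) * K ^ p = lam)
    (hc : 0 < c) (hKc : K * c < piP p) (w w' : ℝ → ℝ)
    (hw' : ContinuousOn w' (Set.Icc 0 c))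
    (hw : ∀ x ∈ Set.Icc (0:ℝ) c, HasDerivWithinAt w (w' x) (Set.Icc 0 c) x)
    (hw0 : w 0 = 0) :
    K ^ (p - 1) * Fcot p (K * c) * |w c| ^ p ≤
      ∫ x in (0:ℝ)..c, (|w' x| ^ p - lam * |w x| ^ p) := by
  have hp0 : 0 < p := by linarith
  have hp1 : 0 < p - 1 := by linarith
  have hP := piP_pos hp
  have hwc : ContinuousOn w (Set.Icc 0 c) := fun x hx => (hw x hx).continuousWithinAt
  have hwd : ∀ x ∈ Set.Ioo 0 c, HasDerivAt w (w' x) x := fun x hx =>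
    (hw x ⟨hx.1.le, hx.2.le⟩).hasDerivAt (Icc_mem_nhds hx.1 hx.2)
  have hKx : ∀ x ∈ Set.Ioc 0 c, K * x ∈ Set.Ioo 0 (piP p) := fun x hx =>
    ⟨mul_pos hK hx.1, (mul_le_mul_of_nonneg_left hx.2 hK.le).trans_lt hKc⟩
  have hF : ∀ x ∈ Set.Ioc 0 c, HasDerivAt (fun x => Fcot p (K * x))
      (-(p - 1) * (1 + |Fcot p (K * x)| ^ (p / (p - 1))) * K) x := fun x hx => by
    have h1 : HasDerivAt (fun y => K * y) K x := by
      simpa using (hasDerivAt_id x).const_mul K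
    exact (Fcot_deriv hp (hKx x hx)).comp x h1
  obtain ⟨C, hC⟩ := isCompact_Icc.exists_bound_of_continuousOn hw'
  have hwb : ∀ x ∈ Set.Icc 0 c, |w x| ≤ C * x := by
    intro x hx
    have := (convex_Icc 0 c).norm_image_sub_le_of_norm_hasDerivWithin_le hw hC
      (⟨le_rfl, hc.le⟩ : (0:ℝ) ∈ Set.Icc 0 c) hx
    rwa [hw0, sub_zero, sub_zero, Real.norm_eq_abs, Real.norm_eq_abs, abs_of_nonneg hx.1] at this
  have hC0 : 0 ≤ C := (norm_nonneg _).trans (hC 0 ⟨le_rfl, hc.le⟩)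
  set g : ℝ → ℝ := fun x => K ^ (p - 1) * Fcot p (K * x) * |w x| ^ p with hg
  have hg0 : g 0 = 0 := by simp [hg, hw0, Real.zero_rpow hp0.ne']
  have hgc : ContinuousOn g (Set.Icc 0 c) := by
    intro x hx
    rcases eq_or_lt_of_le hx.1 with h | h
    · subst h
      unfold ContinuousWithinAt
      rw [hg0]
      have hlim : Filter.Tendsto (fun x : ℝ => C ^ p * x) (nhdsWithin 0 (Set.Icc 0 c)) (nhds 0) := by
        have : Continuous (fun x : ℝ => C ^ p * x) := by fun_prop
        have := this.tendsto 0
        rw [mul_zero] at this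
        exact this.mono_left nhdsWithin_le_nhds
      have hev : ∀ᶠ x in nhdsWithin (0:ℝ) (Set.Icc 0 c), x ∈ Set.Icc 0 c ∧ x < piP p / 2 / K :=
        Filter.Eventually.and self_mem_nhdsWithin
          (nhdsWithin_le_nhds (Iio_mem_nhds (by positivity)))
      have hbd : ∀ᶠ x in nhdsWithin (0:ℝ) (Set.Icc 0 c), 0 ≤ g x ∧ g x ≤ C ^ p * x := by
        filter_upwards [hev] with x hx
        obtain ⟨hx, hxs⟩ := hx
        rcases eq_or_lt_of_le hx.1 with h | h
        · rw [← h, hg0]; simp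
        · have hm : K * x ∈ Set.Ioo 0 (piP p / 2) :=
            ⟨mul_pos hK h, by rw [lt_div_iff₀ hK] at hxs; linarith⟩
          have hle := hcot_le hp hm
          have hpos := hcot_pos hp hm
          simp only [hg]
          rw [Fcot_left hm.2.le]
          refine ⟨by positivity, ?_⟩
          calc K ^ (p - 1) * hcot p (K * x) * |w x| ^ p
              ≤ K ^ (p - 1) * (K * x) ^ (1 - p) * (C * x) ^ p := by
                gcongr
                exact hwb x hx
            _ = C ^ p * x := by
                rw [Real.mul_rpow hK.le h.le, Real.mul_rpow hC0 h.le]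
                have e1 : K ^ (p - 1) * K ^ (1 - p) = 1 := by
                  rw [← Real.rpow_add hK]; simp
                have e2 : x ^ (1 - p) * x ^ p = x := by
                  rw [← Real.rpow_add h]; simp
                calc _ = (K ^ (p - 1) * K ^ (1 - p)) * C ^ p * (x ^ (1 - p) * x ^ p) := by ring
                  _ = _ := by rw [e1, e2, one_mul]
      exact tendsto_of_tendsto_of_tendsto_of_le_of_le' tendsto_const_nhds hlim
        (hbd.mono fun x h => h.1) (hbd.mono fun x h => h.2)
    · refine ContinuousWithinAt.mul (ContinuousWithinAt.mul continuousWithinAt_const ?_) ?_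
      · exact (hF x ⟨h, hx.2⟩).continuousAt.continuousWithinAt
      · exact (hwc x hx).abs.rpow_const (Or.inr hp0.le)
  have hφ : ContinuousOn (fun x => |w' x| ^ p - lam * |w x| ^ p) (Set.Icc 0 c) :=
    (hw'.abs.rpow_const (fun _ _ => Or.inr hp0.le)).sub
      (continuousOn_const.mul (hwc.abs.rpow_const (fun _ _ => Or.inr hp0.le)))
  have hgd : ∀ x ∈ Set.Ioo 0 c, HasDerivAt g
      (K ^ (p - 1) * (-(p - 1) * (1 + |Fcot p (K * x)| ^ (p / (p - 1))) * K) * |w x| ^ p +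
        K ^ (p - 1) * Fcot p (K * x) * (p * |w x| ^ (p - 2) * w x * w' x)) x := by
    intro x hx
    have h1 := (hasDerivAt_abs_rpow (w x) hp).comp x (hwd x hx)
    exact ((hF x ⟨hx.1, hx.2.le⟩).const_mul (K ^ (p - 1))).mul h1
  have key := intervalIntegral.sub_le_integral_of_hasDeriv_right_of_le hc.le hgc
    (fun x hx => (hgd x hx).hasDerivWithinAt) hφ.integrableOn_Icc ?_
  · rw [hg0, sub_zero] at key
    exact key
  · intro x hx
    have hy := young_aux hp (K ^ (p - 1) * Fcot p (K * x)) (w x) (w' x)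
    have e : |K ^ (p - 1) * Fcot p (K * x)| ^ (p / (p - 1)) =
        K ^ p * |Fcot p (K * x)| ^ (p / (p - 1)) := by
      rw [abs_mul, abs_of_nonneg (Real.rpow_nonneg hK.le _),
        Real.mul_rpow (Real.rpow_nonneg hK.le _) (abs_nonneg _), ← Real.rpow_mul hK.le,
        show (p - 1) * (p / (p - 1)) = p by field_simp]
    rw [e] at hy
    have e2 : K ^ p = K ^ (p - 1) * K := by
      rw [← Real.rpow_add_one hK.ne']; simp
    rw [← hlam]
    rw [e2] at hy ⊢
    linarith

lemma cotP_pow {p x : ℝ} (hp : 1 < p) (hx : x ∈ Set.Ioo 0 (piP p / 2)) :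
    cotP p x ^ (p - 1) = Fcot p x := by
  rw [Fcot_left hx.2.le, hcot_eq hp hx]
  simp [cotP, cosP, sinP, hx.2.le]

/-- Sobolev-type inequality for `0 < λ < p - 1`, `K = (λ/(p-1))^(1/p)`:
`2 K^(p-1) (cot_p (K π_p/2))^(p-1) (max |u|)^p ≤ ∫ |u'|^p - λ ∫ |u|^p`
for `u` continuously differentiable on `[0, π_p]` with `u(0) = u(π_p) = 0`. -/
theorem sobolev_pos_lambda (p lam K : ℝ) (hp : 1 < p)
    (hlam0 : 0 < lam) (hlam1 : lam < p - 1)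
    (hK : K = (lam / (p - 1)) ^ (1 / p))
    (u u' : ℝ → ℝ)
    (hu' : ContinuousOn u' (Set.Icc 0 (piP p)))
    (huderiv : ∀ x ∈ Set.Icc (0:ℝ) (piP p), HasDerivWithinAt u (u' x) (Set.Icc 0 (piP p)) x)
    (hu0 : u 0 = 0) (hupi : u (piP p) = 0) :
    2 * K ^ (p - 1) * (cotP p (K * piP p / 2)) ^ (p - 1) *
        (sSup ((fun x => |u x|) '' Set.Icc 0 (piP p))) ^ p ≤
      (∫ x in (0:ℝ)..piP p, |u' x| ^ p) - lam * ∫ x in (0:ℝ)..piP p, |u x| ^ p := by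
  have hp0 : 0 < p := by linarith
  have hp1 : 0 < p - 1 := by linarith
  have hP := piP_pos hp
  have hr0 : 0 < lam / (p - 1) := div_pos hlam0 hp1
  have hK0 : 0 < K := by rw [hK]; exact Real.rpow_pos_of_pos hr0 _
  have hK1 : K < 1 := by
    rw [hK]
    exact Real.rpow_lt_one hr0.le ((div_lt_one hp1).2 hlam1) (by positivity)
  have hKl : (p - 1) * K ^ p = lam := by
    rw [hK, ← Real.rpow_mul hr0.le, show 1 / p * p = 1 by field_simp, Real.rpow_one]
    field_simp
  have huc : ContinuousOn u (Set.Icc 0 (piP p)) := fun x hx => (huderiv x hx).continuousWithinAt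
  obtain ⟨c, hc, hmax⟩ := isCompact_Icc.exists_isMaxOn
    (Set.nonempty_Icc.2 hP.le) huc.abs
  have hsup : sSup ((fun x => |u x|) '' Set.Icc 0 (piP p)) = |u c| := by
    refine IsGreatest.csSup_eq ⟨⟨c, hc, rfl⟩, ?_⟩
    rintro _ ⟨x, hx, rfl⟩
    exact hmax hx
  rw [hsup]
  have hi1 : ContinuousOn (fun x => |u' x| ^ p) (Set.Icc 0 (piP p)) :=
    hu'.abs.rpow_const (fun _ _ => Or.inr hp0.le)
  have hi2 : ContinuousOn (fun x => |u x| ^ p) (Set.Icc 0 (piP p)) :=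
    huc.abs.rpow_const (fun _ _ => Or.inr hp0.le)
  by_cases h0 : u c = 0
  · have hz : ∀ x ∈ Set.Icc 0 (piP p), u x = 0 := by
      intro x hx
      have : |u x| ≤ |u c| := hmax hx
      rw [h0, abs_zero] at this
      exact abs_nonpos_iff.1 this
    have hI : ∫ x in (0:ℝ)..piP p, |u x| ^ p = 0 := by
      rw [intervalIntegral.integral_congr (g := fun _ => (0:ℝ))]
      · simp
      · intro x hx
        rw [Set.uIcc_of_le hP.le] at hx
        simp [hz x hx, Real.zero_rpow hp0.ne']
    rw [hI, h0, abs_zero, Real.zero_rpow hp0.ne', mul_zero, mul_zero, sub_zero]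
    exact intervalIntegral.integral_nonneg hP.le (fun x _ => by positivity)
  have hc0 : 0 < c := lt_of_le_of_ne hc.1 (fun h => h0 (by rw [← h, hu0]))
  have hcP : c < piP p := lt_of_le_of_ne hc.2 (fun h => h0 (by rw [h, hupi]))
  set φ : ℝ → ℝ := fun x => |u' x| ^ p - lam * |u x| ^ p with hφ
  have hφc : ContinuousOn φ (Set.Icc 0 (piP p)) := hi1.sub (continuousOn_const.mul hi2)
  have hs1 : Set.Icc 0 c ⊆ Set.Icc 0 (piP p) := Set.Icc_subset_Icc_right hc.2
  have A := half_ineq hp hK0 hKl hc0 (by nlinarith) u u' (hu'.mono hs1)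
    (fun x hx => (huderiv x (hs1 hx)).mono hs1) hu0
  have hmaps : Set.MapsTo (fun x => piP p - x) (Set.Icc 0 (piP p - c)) (Set.Icc 0 (piP p)) := by
    intro x hx
    exact ⟨by linarith [hx.2], by linarith [hx.1]⟩
  have B := half_ineq hp hK0 hKl (c := piP p - c) (by linarith) (by nlinarith)
    (fun x => u (piP p - x)) (fun x => -u' (piP p - x))
    ((hu'.comp (by fun_prop) hmaps).neg)
    (fun x hx => by
      have h1 : HasDerivWithinAt (fun y => piP p - y) (-1) (Set.Icc 0 (piP p - c)) x :=
        ((hasDerivAt_id _).const_sub _).hasDerivWithinAt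
      exact ((huderiv _ (hmaps hx)).comp x h1 hmaps).congr_deriv (by ring)) (by simpa using hupi)
  have eB : ∫ x in (0:ℝ)..(piP p - c), (|-u' (piP p - x)| ^ p - lam * |u (piP p - x)| ^ p) =
      ∫ x in c..piP p, φ x := by
    have := intervalIntegral.integral_comp_sub_left φ (piP p) (a := 0) (b := piP p - c)
    simp only [sub_sub_cancel, sub_zero] at this
    rw [← this]
    simp [hφ]
  rw [eB] at B
  simp only [sub_sub_cancel] at B
  have hint : ∀ a ∈ Set.Icc 0 (piP p), ∀ b ∈ Set.Icc 0 (piP p),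
      IntervalIntegrable φ MeasureTheory.volume a b := fun a ha b hb =>
    (hφc.mono (Set.uIcc_subset_Icc ha hb)).intervalIntegrable
  have hsum := intervalIntegral.integral_add_adjacent_intervals
    (hint 0 ⟨le_rfl, hP.le⟩ c hc) (hint c hc (piP p) ⟨hP.le, le_rfl⟩)
  have hsplit : ∫ x in (0:ℝ)..piP p, φ x =
      (∫ x in (0:ℝ)..piP p, |u' x| ^ p) - lam * ∫ x in (0:ℝ)..piP p, |u x| ^ p := by
    rw [← intervalIntegral.integral_const_mul]
    refine intervalIntegral.integral_sub ?_ ?_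
    · exact ContinuousOn.intervalIntegrable (by rwa [Set.uIcc_of_le hP.le])
    · exact (ContinuousOn.intervalIntegrable (by rwa [Set.uIcc_of_le hP.le])).const_mul _
  rw [← hsplit, ← hsum]
  have hm1 : K * piP p / 2 < piP p / 2 := by nlinarith
  have hm0 : 0 < K * piP p / 2 := by positivity
  rw [cotP_pow hp ⟨hm0, hm1⟩]
  have hkey : 2 * Fcot p (K * piP p / 2) ≤ Fcot p (K * c) + Fcot p (K * (piP p - c)) := by
    have hKc := mul_pos hK0 hc0
    have hKc2 := mul_pos hK0 (sub_pos.2 hcP)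
    rcases le_total c (piP p / 2) with h | h
    · have := Fcot_sum hp hm1.le (t := K * piP p / 2 - K * c) (by nlinarith) (by linarith)
      rw [show K * piP p / 2 - (K * piP p / 2 - K * c) = K * c by ring,
        show K * piP p / 2 + (K * piP p / 2 - K * c) = K * (piP p - c) by ring] at this
      exact this
    · have := Fcot_sum hp hm1.le (t := K * c - K * piP p / 2) (by nlinarith) (by linarith)
      rw [show K * piP p / 2 - (K * c - K * piP p / 2) = K * (piP p - c) by ring,
        show K * piP p / 2 + (K * c - K * piP p / 2) = K * c by ring] at this
      linarith
  have hpos : 0 ≤ K ^ (p - 1) * |u c| ^ p := by positivity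
  have := mul_le_mul_of_nonneg_left hkey hpos
  linarith
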